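/- Weber's modular function f₀ satisfies f₀(√−3/3) = f₀(√−3) = 2^{1/3}, where √−3 denotes i√3. -/

import Mathlib

/-- The Dedekind eta function `η(τ) = e^{πiτ/12} ∏_{n≥1} (1 - e^{2πinτ})`. -/
noncomputable def dedekindEta (τ : ℂ) : ℂ :=
  Complex.exp (Real.pi * Complex.I * τ / 12) *
    ∏' n : ℕ, (1 - Complex.exp (2 * Real.pi * Complex.I * ((n : ℂ) + 1) * τ))

/-- Weber's modular function `f₀(τ) = e^{-πi/24} · η((τ+1)/2)/η(τ)`. -/
noncomputable def weberF0 (τ : ℂ) : ℂ :=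
  Complex.exp (-(Real.pi * Complex.I) / 24) * dedekindEta ((τ + 1) / 2) / dedekindEta τ

open Complex in
lemma dedekindEta_eq_eta (z : ℂ) : dedekindEta z = ModularForm.eta z := by
  unfold dedekindEta ModularForm.eta
  congr 1
  · rw [Function.Periodic.qParam]
    congr 1
    push_cast
    ring
  · simp_rw [ModularForm.eta_q_eq_cexp]

open Complex in
lemma dedekindEta_eq_tprod_pow (z : ℂ) :
    dedekindEta z = exp (Real.pi * I * z / 12) *
      ∏' n : ℕ, (1 - exp (2 * Real.pi * I * z) ^ (n + 1)) := by
  unfold dedekindEta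
  congr 1
  refine tprod_congr fun n ↦ ?_
  rw [← exp_nat_mul]
  push_cast
  ring_nf

lemma dedekindEta_ne_zero {z : ℂ} (hz : 0 < z.im) : dedekindEta z ≠ 0 := by
  rw [dedekindEta_eq_eta]
  exact ModularForm.eta_ne_zero hz

open Complex in
lemma norm_dedekindEta_add_one (z : ℂ) : ‖dedekindEta (z + 1)‖ = ‖dedekindEta z‖ := by
  have h : exp (2 * Real.pi * I * (z + 1)) = exp (2 * Real.pi * I * z) := by
    rw [mul_add, mul_one, exp_periodic]
  rw [dedekindEta_eq_tprod_pow, dedekindEta_eq_tprod_pow, h, norm_mul, norm_mul, norm_exp, norm_exp]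
  congr 2
  simp [div_eq_mul_inv]

lemma norm_dedekindEta_neg_one_div_pow_four {z : ℂ} (hz : 0 < z.im) :
    ‖dedekindEta (-1 / z)‖ ^ 4 = Complex.normSq z * ‖dedekindEta z‖ ^ 4 := by
  have hsqrt (w : ℂ) : ‖Complex.sqrt w‖ ^ 2 = ‖w‖ := by
    rw [← norm_pow, Complex.sqrt, ← Nat.cast_ofNat, Complex.cpow_nat_inv_pow _ two_ne_zero]
  have h : ModularForm.eta (-1 / z) = (Complex.sqrt Complex.I)⁻¹ *
      (Complex.sqrt z * ModularForm.eta z) := ModularForm.eta_comp_eq_csqrt_I_inv hz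
  rw [dedekindEta_eq_eta, dedekindEta_eq_eta, h, norm_mul, norm_mul, norm_inv, mul_pow, mul_pow,
    inv_pow, pow_mul ‖Complex.sqrt Complex.I‖ 2 2, pow_mul ‖Complex.sqrt z‖ 2 2, hsqrt, hsqrt,
    Complex.normSq_eq_norm_sq]
  simp

/-- With `P(q) = ∏ (1 - q ^ n)`, one has `P(q) P(-q) P(q⁴) = P(q²)³`. -/
lemma tprod_one_sub_pow_mul_neg_mul_pow_four {q : ℂ} (hq : ‖q‖ < 1) :
    (∏' n : ℕ, (1 - q ^ (n + 1))) * (∏' n : ℕ, (1 - (-q) ^ (n + 1))) *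
      (∏' n : ℕ, (1 - (q ^ 4) ^ (n + 1))) = (∏' n : ℕ, (1 - (q ^ 2) ^ (n + 1))) ^ 3 := by
  have hodd {x : ℂ} (hx : ‖x‖ < 1) : Multipliable fun n : ℕ ↦ 1 - x ^ (2 * n + 1) := by
    refine (multipliable_one_add_of_summable (f := fun n : ℕ ↦ -x ^ (2 * n + 1)) ?_).congr
      fun n ↦ (sub_eq_add_neg _ _).symm
    have := (summable_geometric_of_lt_one (norm_nonneg x) hx).comp_injective
      (i := fun n : ℕ ↦ 2 * n + 1) (fun a b h ↦ by simpa using h)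
    simpa [Function.comp_def] using this
  have hsq {x : ℂ} (hx : ‖x‖ < 1) : ‖x ^ 2‖ < 1 := by
    rw [norm_pow]
    exact pow_lt_one₀ (norm_nonneg _) hx two_ne_zero
  have hsplit {x : ℂ} (hx : ‖x‖ < 1) : ∏' n : ℕ, (1 - x ^ (n + 1)) =
      (∏' n : ℕ, (1 - x ^ (2 * n + 1))) * ∏' n : ℕ, (1 - (x ^ 2) ^ (n + 1)) := by
    rw [← tprod_even_mul_odd (f := fun n : ℕ ↦ 1 - x ^ (n + 1)) (hodd hx)]
    · congr 1
      exact tprod_congr fun n ↦ by ring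
    · exact (ModularForm.multipliable_one_sub_pow (hsq hx)).congr fun n ↦ by ring
  have hO : (∏' n : ℕ, (1 - q ^ (2 * n + 1))) * (∏' n : ℕ, (1 - (-q) ^ (2 * n + 1))) =
      ∏' n : ℕ, (1 - (q ^ 2) ^ (2 * n + 1)) := by
    rw [← (hodd hq).tprod_mul (hodd (by simpa using hq))]
    refine tprod_congr fun n ↦ ?_
    rw [Odd.neg_pow ⟨n, rfl⟩]
    ring
  have h4 : (q ^ 2) ^ 2 = q ^ 4 := by ring
  have hq' : ‖-q‖ < 1 := by simpa using hq
  have e1 := hsplit hq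
  have e2 := hsplit hq'
  have e3 := hsplit (hsq hq)
  rw [neg_sq] at e2
  rw [h4] at e3
  rw [e1, e2]
  linear_combination (∏' n : ℕ, (1 - (q ^ 2) ^ (n + 1))) ^ 2 *
    ((∏' n : ℕ, (1 - (q ^ 4) ^ (n + 1))) * hO - e3)

open Complex in
lemma norm_dedekindEta_mul_mul {z : ℂ} (hz : 0 < z.im) :
    ‖dedekindEta (z / 2)‖ * ‖dedekindEta ((z + 1) / 2)‖ * ‖dedekindEta (2 * z)‖ =
      ‖dedekindEta z‖ ^ 3 := by
  have hq : ‖exp (Real.pi * I * z)‖ < 1 := by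
    rw [norm_exp]
    simpa using mul_pos Real.pi_pos hz
  have h1 : exp (2 * Real.pi * I * (z / 2)) = exp (Real.pi * I * z) := by ring_nf
  have h2 : exp (2 * Real.pi * I * ((z + 1) / 2)) = -exp (Real.pi * I * z) := by
    rw [show 2 * Real.pi * I * ((z + 1) / 2) = Real.pi * I * z + Real.pi * I by ring,
      exp_add, exp_pi_mul_I, mul_neg_one]
  have h3 : exp (2 * Real.pi * I * (2 * z)) = exp (Real.pi * I * z) ^ 4 := by
    rw [← exp_nat_mul]
    push_cast
    ring_nf
  have h4 : exp (2 * Real.pi * I * z) = exp (Real.pi * I * z) ^ 2 := by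
    rw [← exp_nat_mul]
    push_cast
    ring_nf
  simp only [dedekindEta_eq_tprod_pow, h1, h2, h3, h4, norm_mul, mul_pow]
  rw [← norm_pow (∏' n : ℕ, (1 - (exp (Real.pi * I * z) ^ 2) ^ (n + 1))),
    ← tprod_one_sub_pow_mul_neg_mul_pow_four hq, norm_mul, norm_mul]
  have he : ‖exp (Real.pi * I * (z / 2) / 12)‖ * ‖exp (Real.pi * I * ((z + 1) / 2) / 12)‖ *
      ‖exp (Real.pi * I * (2 * z) / 12)‖ = ‖exp (Real.pi * I * z / 12)‖ ^ 3 := by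
    simp only [norm_exp, ← Real.exp_add, ← Real.exp_nat_mul]
    congr 1
    simp [div_eq_mul_inv]
    ring
  rw [← he]
  ring

open Complex ComplexOrder in
/-- Weber's function takes nonnegative real values on the imaginary axis. -/
lemma weberF0_ofReal_mul_I_nonneg {t : ℝ} (ht : 0 < t) : 0 ≤ weberF0 (t * I) := by
  have hr : Real.exp (-(Real.pi * t)) ≤ 1 :=
    Real.exp_le_one_iff.2 (by have := Real.pi_pos; simp; positivity)
  have h1 : exp (2 * Real.pi * I * ((t * I + 1) / 2)) = -(Real.exp (-(Real.pi * t)) : ℝ) := by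
    rw [show 2 * Real.pi * I * ((t * I + 1) / 2) = (-(Real.pi * t) : ℝ) + Real.pi * I by
      push_cast; linear_combination Real.pi * t * I_sq, exp_add, exp_pi_mul_I, mul_neg_one,
      ofReal_exp]
  have h2 : exp (2 * Real.pi * I * (t * I)) = (Real.exp (-(2 * Real.pi * t)) : ℝ) := by
    rw [ofReal_exp]
    congr 1
    push_cast
    linear_combination 2 * Real.pi * t * I_sq
  have h3 : exp (-(Real.pi * I) / 24) * exp (Real.pi * I * ((t * I + 1) / 2) / 12) =
      (Real.exp (-(Real.pi * t) / 24) : ℝ) := by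
    rw [ofReal_exp, ← exp_add]
    congr 1
    push_cast
    linear_combination Real.pi * t / 24 * I_sq
  have h4 : exp (Real.pi * I * (t * I) / 12) = (Real.exp (-(Real.pi * t) / 12) : ℝ) := by
    rw [ofReal_exp]
    congr 1
    push_cast
    linear_combination Real.pi * t / 12 * I_sq
  have hnonneg {x : ℝ} (hx : |x| ≤ 1) : 0 ≤ ∏' n : ℕ, (1 - (x : ℂ) ^ (n + 1)) := by
    refine tprod_nonneg fun n ↦ ?_
    have : x ^ (n + 1) ≤ 1 := (le_abs_self _).trans (by
      rw [abs_pow]; exact pow_le_one₀ (abs_nonneg _) hx)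
    exact_mod_cast sub_nonneg.2 this
  rw [weberF0, dedekindEta_eq_tprod_pow, dedekindEta_eq_tprod_pow, h1, h2, ← mul_assoc, h3, h4,
    ← ofReal_neg]
  have hr' : Real.exp (-(2 * Real.pi * t)) ≤ 1 := Real.exp_le_one_iff.2 (by
    have := Real.pi_pos; simp; positivity)
  refine div_nonneg (mul_nonneg ?_ (hnonneg ?_)) (mul_nonneg ?_ (hnonneg ?_))
  · exact_mod_cast (Real.exp_pos _).le
  · rwa [abs_neg, Real.abs_exp]
  · exact_mod_cast (Real.exp_pos _).le
  · rwa [Real.abs_exp]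

open Complex in
lemma norm_weberF0 (z : ℂ) :
    ‖weberF0 z‖ = ‖dedekindEta ((z + 1) / 2)‖ / ‖dedekindEta z‖ := by
  rw [weberF0, norm_div, norm_mul, norm_exp]
  simp [div_eq_mul_inv]

open Complex in
lemma norm_dedekindEta_sqrt_three_mul_I_div_three :
    ‖dedekindEta (Real.sqrt 3 * I / 3)‖ ^ 4 = 3 * ‖dedekindEta (Real.sqrt 3 * I)‖ ^ 4 := by
  have hs : (Real.sqrt 3 : ℂ) ^ 2 = 3 := by exact_mod_cast Real.sq_sqrt (by norm_num : (0:ℝ) ≤ 3)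
  have h := norm_dedekindEta_neg_one_div_pow_four (z := Real.sqrt 3 * I) (by simp)
  rw [show -1 / (Real.sqrt 3 * I) = Real.sqrt 3 * I / 3 by
    field_simp
    linear_combination -hs * I ^ 2 - 3 * I_sq] at h
  simpa [normSq_mul] using h

open Complex in
/-- The values of `|η|` at `(1 + √-3) / 2` and `√-3`, compared through the three index-two
sublattices of the hexagonal lattice. -/
lemma norm_dedekindEta_one_add_sqrt_neg_three_div_two :
    ‖dedekindEta ((Real.sqrt 3 * I + 1) / 2)‖ ^ 12 = 16 * ‖dedekindEta (Real.sqrt 3 * I)‖ ^ 12 := by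
  have hs : (Real.sqrt 3 : ℂ) ^ 2 = 3 := by exact_mod_cast Real.sq_sqrt (by norm_num : (0:ℝ) ≤ 3)
  have hsI : (Real.sqrt 3 * I) ^ 2 = -3 := by rw [mul_pow, hs, I_sq]; ring
  have hss : Real.sqrt 3 * Real.sqrt 3 = 3 := Real.mul_self_sqrt (by norm_num)
  set σ : ℂ := (Real.sqrt 3 * I + 1) / 2 with hσ
  have h2 : ‖dedekindEta (2 * σ)‖ = ‖dedekindEta (Real.sqrt 3 * I)‖ := by
    rw [← norm_dedekindEta_add_one (Real.sqrt 3 * I), hσ]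
    ring_nf
  have h0 : ‖dedekindEta (σ / 2)‖ ^ 4 = 4 * ‖dedekindEta (Real.sqrt 3 * I)‖ ^ 4 := by
    have him : 0 < (Real.sqrt 3 * I - 1).im := by simp
    have hne : Real.sqrt 3 * I - 1 ≠ 0 := fun h ↦ by simp [h] at him
    have h := norm_dedekindEta_neg_one_div_pow_four him
    rw [show -1 / (Real.sqrt 3 * I - 1) = σ / 2 by
        rw [hσ, div_eq_iff hne]; linear_combination -hsI / 4,
      ← norm_dedekindEta_add_one (Real.sqrt 3 * I - 1), sub_add_cancel] at h
    rw [h]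
    congr 1
    simp [normSq_apply, hss]
    norm_num
  have h1 : ‖dedekindEta ((σ + 1) / 2)‖ ^ 4 = 4 * ‖dedekindEta (Real.sqrt 3 * I)‖ ^ 4 := by
    have him : 0 < (Real.sqrt 3 * I / 3 - 1).im := by simp
    have hne : Real.sqrt 3 * I / 3 - 1 ≠ 0 := fun h ↦ by simp [h] at him
    have h := norm_dedekindEta_neg_one_div_pow_four him
    have hn : normSq (Real.sqrt 3 * I / 3 - 1) = 4 / 3 := by
      simp [normSq_apply]
      linarith
    rw [show -1 / (Real.sqrt 3 * I / 3 - 1) = (σ + 1) / 2 by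
        rw [hσ, div_eq_iff hne]; linear_combination -hsI / 12,
      ← norm_dedekindEta_add_one (Real.sqrt 3 * I / 3 - 1), sub_add_cancel,
      norm_dedekindEta_sqrt_three_mul_I_div_three, hn] at h
    rw [h]
    ring
  have h := norm_dedekindEta_mul_mul (z := σ) (by simp [hσ])
  rw [h2] at h
  calc ‖dedekindEta σ‖ ^ 12 = (‖dedekindEta σ‖ ^ 3) ^ 4 := by ring
    _ = 16 * ‖dedekindEta (Real.sqrt 3 * I)‖ ^ 12 := by
      rw [← h, mul_pow, mul_pow, h0, h1]
      ring

open Complex ComplexOrder in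
lemma eq_two_rpow_of_nonneg_of_norm_pow {w : ℂ} (hw : 0 ≤ w) (h : ‖w‖ ^ 12 = 16) :
    w = (((2 : ℝ) ^ ((1 : ℝ) / 3) : ℝ) : ℂ) := by
  rw [← norm_of_nonneg' hw]
  congr 1
  refine (pow_left_inj₀ (norm_nonneg w) (by positivity) (by norm_num : 12 ≠ 0)).1 ?_
  rw [h, ← Real.rpow_mul_natCast (by norm_num)]
  norm_num

theorem weberF0_sqrt_neg3 :
    weberF0 (Real.sqrt 3 * Complex.I / 3) = (((2 : ℝ) ^ ((1 : ℝ) / 3) : ℝ) : ℂ) ∧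
      weberF0 (Real.sqrt 3 * Complex.I) = (((2 : ℝ) ^ ((1 : ℝ) / 3) : ℝ) : ℂ) := by
  have hA : ‖dedekindEta (Real.sqrt 3 * Complex.I)‖ ^ 12 ≠ 0 :=
    pow_ne_zero _ (norm_ne_zero_iff.2 (dedekindEta_ne_zero (by simp)))
  constructor
  · refine eq_two_rpow_of_nonneg_of_norm_pow ?_ ?_
    · rw [mul_div_right_comm]
      exact_mod_cast weberF0_ofReal_mul_I_nonneg (t := Real.sqrt 3 / 3) (by positivity)
    · have hs : (Real.sqrt 3 * Complex.I) ^ 2 = -3 := by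
        rw [mul_pow, Complex.I_sq, ← Complex.ofReal_pow, Real.sq_sqrt (by norm_num)]
        norm_num
      set σ : ℂ := (Real.sqrt 3 * Complex.I + 1) / 2 with hσ
      have him : 0 < (σ - 1 - 1).im := by simp [hσ]
      have hne : σ - 1 - 1 ≠ 0 := fun h ↦ by simp [h] at him
      have h := norm_dedekindEta_neg_one_div_pow_four him
      have hn : Complex.normSq (σ - 1 - 1) = 3 := by
        have hss : Real.sqrt 3 * Real.sqrt 3 = 3 := Real.mul_self_sqrt (by norm_num)
        simp [Complex.normSq_apply, hσ]
        linarith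
      rw [show -1 / (σ - 1 - 1) = (Real.sqrt 3 * Complex.I / 3 + 1) / 2 by
          rw [hσ, div_eq_iff hne]; linear_combination -hs / 12,
        ← norm_dedekindEta_add_one (σ - 1 - 1), sub_add_cancel,
        ← norm_dedekindEta_add_one (σ - 1), sub_add_cancel, hn] at h
      rw [norm_weberF0, div_pow, pow_mul _ 4 3, pow_mul _ 4 3, h,
        norm_dedekindEta_sqrt_three_mul_I_div_three, mul_pow, mul_pow, ← pow_mul, ← pow_mul,
        mul_div_mul_left _ _ (by norm_num), norm_dedekindEta_one_add_sqrt_neg_three_div_two,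
        mul_div_cancel_right₀ _ hA]
  · refine eq_two_rpow_of_nonneg_of_norm_pow (weberF0_ofReal_mul_I_nonneg (by positivity)) ?_
    rw [norm_weberF0, div_pow, norm_dedekindEta_one_add_sqrt_neg_three_div_two,
      mul_div_cancel_right₀ _ hA]
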